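/- Let A be a unital C*-algebra and let (f_n) be a sequence of positive contractions in A such that sup_{τ ∈ T(A)} τ(f_n) → 0 as n → ∞. Then there exists a sequence (f̃_n) of positive contractions in A with ‖f̃_n − f_n‖ → 0 (so that (f̃_n) and (f_n) represent the same element of the sequence algebra A^∞ = ℓ^∞(ℕ,A)/c₀(A)) and sup_{τ ∈ T(A)} d_τ(f̃_n) → 0 as n → ∞. -/

import Mathlib

/- Statement 11: if (f_n) are positive contractions with sup_{τ ∈ T(A)} τ(f_n) → 0,
   then there are positive contractions f̃_n with ‖f̃_n − f_n‖ → 0 and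
   sup_{τ ∈ T(A)} d_τ(f̃_n) → 0. -/

open scoped ComplexOrder
open Filter

/-- A tracial state on a unital C*-algebra. -/
def IsTracialState {A : Type*} [CStarAlgebra A] (τ : A →L[ℂ] ℂ) : Prop :=
  τ 1 = 1 ∧ (∀ a : A, 0 ≤ τ (star a * a)) ∧ ∀ a b : A, τ (a * b) = τ (b * a)

/-- The dimension function `d_τ(f) = lim_n τ((1/n + f)⁻¹ f)`. -/
noncomputable def dimFn {A : Type*} [CStarAlgebra A] (τ : A →L[ℂ] ℂ) (f : A) : ℝ :=
  limUnder atTop fun n : ℕ => (τ (Ring.inverse ((n : ℂ)⁻¹ • (1 : A) + f) * f)).re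

/-- The real part of a tracial state is monotone. -/
lemma IsTracialState.re_mono {A : Type*} [CStarAlgebra A] [PartialOrder A] [StarOrderedRing A]
    {τ : A →L[ℂ] ℂ} (hτ : IsTracialState τ) {a b : A} (hab : a ≤ b) : (τ a).re ≤ (τ b).re := by
  obtain ⟨c, hc⟩ := CStarAlgebra.nonneg_iff_eq_star_mul_self.mp (sub_nonneg.mpr hab)
  have h := (Complex.le_def.mp (hτ.2.1 c)).1
  rw [← hc, map_sub, Complex.sub_re, Complex.zero_re] at h
  linarith

/-- The approximants in the definition of `dimFn`, in terms of the functional calculus. -/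
lemma inverse_smul_one_add_mul_eq_cfc {A : Type*} [CStarAlgebra A] [PartialOrder A]
    [StarOrderedRing A] {g : A} (hg : 0 ≤ g) (n : ℕ) :
    Ring.inverse (((n + 1 : ℕ) : ℂ)⁻¹ • (1 : A) + g) * g =
      cfc (fun t : ℝ => (((n + 1 : ℕ) : ℝ)⁻¹ + t)⁻¹ * t) g := by
  have hsa : IsSelfAdjoint g := IsSelfAdjoint.of_nonneg hg
  have hne : ∀ t ∈ spectrum ℝ g, ((n + 1 : ℕ) : ℝ)⁻¹ + t ≠ 0 := fun t ht => by
    have := spectrum_nonneg_of_nonneg hg ht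
    positivity
  have hsum : ((n + 1 : ℕ) : ℂ)⁻¹ • (1 : A) + g =
      cfc (fun t : ℝ => ((n + 1 : ℕ) : ℝ)⁻¹ + t) g := by
    rw [cfc_const_add _ (fun t : ℝ => t) g, cfc_id' ℝ g, Algebra.algebraMap_eq_smul_one,
      ← Complex.coe_smul]
    push_cast
    rfl
  rw [cfc_mul (fun t : ℝ => (((n + 1 : ℕ) : ℝ)⁻¹ + t)⁻¹) (fun t => t) g
      (ContinuousOn.inv₀ (by fun_prop) hne) (by fun_prop), cfc_id' ℝ g,
    cfc_inv (fun t : ℝ => ((n + 1 : ℕ) : ℝ)⁻¹ + t) g hne, hsum]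

/-- If every approximant of `dimFn τ g` is at most `C`, then `0 ≤ dimFn τ g ≤ C`. -/
lemma IsTracialState.dimFn_mem_Icc {A : Type*} [CStarAlgebra A] [PartialOrder A]
    [StarOrderedRing A] {τ : A →L[ℂ] ℂ} (hτ : IsTracialState τ) {g : A} (hg : 0 ≤ g) {C : ℝ}
    (hC : ∀ n : ℕ, (τ (cfc (fun t : ℝ => (((n + 1 : ℕ) : ℝ)⁻¹ + t)⁻¹ * t) g)).re ≤ C) :
    dimFn τ g ∈ Set.Icc 0 C := by
  set u : ℕ → ℝ := fun n => (τ (cfc (fun t : ℝ => (((n + 1 : ℕ) : ℝ)⁻¹ + t)⁻¹ * t) g)).re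
  have hspec : ∀ t ∈ spectrum ℝ g, 0 ≤ t := fun t ht => spectrum_nonneg_of_nonneg hg ht
  have hcont : ∀ n : ℕ,
      ContinuousOn (fun t : ℝ => (((n + 1 : ℕ) : ℝ)⁻¹ + t)⁻¹ * t) (spectrum ℝ g) := fun n =>
    (ContinuousOn.inv₀ (by fun_prop) fun t ht => by
      have := hspec t ht
      positivity).mul (by fun_prop)
  have hmono : Monotone u := fun m n hmn => hτ.re_mono <|
    cfc_mono (fun t ht => by
      have := hspec t ht
      gcongr) (hcont m) (hcont n)
  have hnonneg : ∀ n, 0 ≤ u n := fun n => by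
    have h0 := hτ.re_mono (cfc_nonneg (a := g)
      (f := fun t : ℝ => (((n + 1 : ℕ) : ℝ)⁻¹ + t)⁻¹ * t) fun t ht => by
        have := hspec t ht
        positivity)
    simpa [u] using h0
  have hlim : Tendsto u atTop (nhds (⨆ n, u n)) :=
    tendsto_atTop_ciSup hmono ⟨C, Set.forall_mem_range.mpr hC⟩
  have hdim : dimFn τ g = ⨆ n, u n := by
    refine Tendsto.limUnder_eq ((tendsto_add_atTop_iff_nat 1).mp ?_)
    simpa only [inverse_smul_one_add_mul_eq_cfc hg] using hlim
  rw [hdim]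
  exact ⟨ge_of_tendsto' hlim hnonneg, le_of_tendsto' hlim hC⟩

/-- A Chebyshev inequality: `d_τ((f - ε)₊) ≤ τ(f) / ε`. -/
lemma IsTracialState.dimFn_cfc_max_sub_mem_Icc {A : Type*} [CStarAlgebra A] [PartialOrder A]
    [StarOrderedRing A] {τ : A →L[ℂ] ℂ} (hτ : IsTracialState τ) {f : A} (hf : 0 ≤ f) {ε : ℝ}
    (hε : 0 < ε) :
    dimFn τ (cfc (fun t : ℝ => max (t - ε) 0) f) ∈ Set.Icc 0 ((τ f).re / ε) := by
  have hsa : IsSelfAdjoint f := IsSelfAdjoint.of_nonneg hf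
  refine hτ.dimFn_mem_Icc (cfc_nonneg fun t _ => le_max_right _ _) fun n => ?_
  have hpos : ∀ t : ℝ, 0 < ((n + 1 : ℕ) : ℝ)⁻¹ + max (t - ε) 0 := fun t =>
    add_pos_of_pos_of_nonneg (by positivity) (le_max_right _ _)
  have hcont : ContinuousOn (fun t : ℝ => (((n + 1 : ℕ) : ℝ)⁻¹ + t)⁻¹ * t)
      ((fun t : ℝ => max (t - ε) 0) '' spectrum ℝ f) := by
    refine (ContinuousOn.inv₀ (by fun_prop) ?_).mul (by fun_prop)
    rintro _ ⟨t, -, rfl⟩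
    exact (hpos t).ne'
  rw [← cfc_comp' (fun t : ℝ => (((n + 1 : ℕ) : ℝ)⁻¹ + t)⁻¹ * t)
    (fun t : ℝ => max (t - ε) 0) f hcont (by fun_prop)]
  have hle : cfc (fun t : ℝ => (((n + 1 : ℕ) : ℝ)⁻¹ + max (t - ε) 0)⁻¹ * max (t - ε) 0) f ≤
      cfc (fun t : ℝ => ε⁻¹ * t) f := by
    refine cfc_mono (fun t ht => ?_)
      (hcont.comp (by fun_prop) (Set.mapsTo_image _ _)) (by fun_prop)
    have ht0 := spectrum_nonneg_of_nonneg hf ht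
    rcases le_total t ε with h | h
    · rw [max_eq_right (by linarith)]
      simp only [mul_zero]
      positivity
    · have h1 : (((n + 1 : ℕ) : ℝ)⁻¹ + max (t - ε) 0)⁻¹ * max (t - ε) 0 ≤ 1 := by
        rw [inv_mul_le_iff₀ (hpos t), mul_one]
        exact le_add_of_nonneg_left (by positivity)
      have h2 : 1 ≤ ε⁻¹ * t := by
        rw [← div_eq_inv_mul, one_le_div hε]
        exact h
      exact h1.trans h2
  have h := hτ.re_mono hle
  rw [cfc_const_mul ε⁻¹ (fun t : ℝ => t) f, cfc_id' ℝ f, ← Complex.coe_smul, map_smul,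
    smul_eq_mul, Complex.re_ofReal_mul] at h
  rwa [div_eq_inv_mul]

/-- Cutting down by `ε` moves a positive element by at most `ε`. -/
lemma norm_cfc_max_sub_sub_self_le {A : Type*} [CStarAlgebra A] [PartialOrder A]
    [StarOrderedRing A] {f : A} (hf : 0 ≤ f) {ε : ℝ} (hε : 0 ≤ ε) :
    ‖cfc (fun t : ℝ => max (t - ε) 0) f - f‖ ≤ ε := by
  have hsa : IsSelfAdjoint f := IsSelfAdjoint.of_nonneg hf
  have : cfc (fun t : ℝ => max (t - ε) 0) f - f = cfc (fun t : ℝ => max (t - ε) 0 - t) f := by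
    rw [cfc_sub (fun t : ℝ => max (t - ε) 0) (fun t => t) f, cfc_id' ℝ f]
  rw [this]
  refine norm_cfc_le hε fun t ht => ?_
  have ht0 := spectrum_nonneg_of_nonneg hf ht
  rw [Real.norm_eq_abs, abs_le]
  rcases max_cases (t - ε) 0 with h | h <;> constructor <;> linarith

/-- Cutting down by `ε` does not increase the norm of a positive element. -/
lemma norm_cfc_max_sub_le {A : Type*} [CStarAlgebra A] [PartialOrder A]
    [StarOrderedRing A] {f : A} (hf : 0 ≤ f) {ε : ℝ} (hε : 0 ≤ ε) :
    ‖cfc (fun t : ℝ => max (t - ε) 0) f‖ ≤ ‖f‖ := by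
  have hsa : IsSelfAdjoint f := IsSelfAdjoint.of_nonneg hf
  refine CStarAlgebra.norm_le_norm_of_nonneg_of_le (cfc_nonneg fun t _ => le_max_right _ _) ?_
  conv_rhs => rw [← cfc_id' ℝ f]
  refine cfc_mono fun t ht => ?_
  exact max_le (by linarith) (spectrum_nonneg_of_nonneg hf ht)

theorem stmt11 {A : Type*} [CStarAlgebra A] [PartialOrder A] [StarOrderedRing A]
    (f : ℕ → A) (hpos : ∀ n, 0 ≤ f n) (hcontr : ∀ n, ‖f n‖ ≤ 1)
    (h : Tendsto
      (fun n => sSup {x : ℝ | ∃ τ : A →L[ℂ] ℂ, IsTracialState τ ∧ x = (τ (f n)).re})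
      atTop (nhds 0)) :
    ∃ g : ℕ → A, (∀ n, 0 ≤ g n) ∧ (∀ n, ‖g n‖ ≤ 1) ∧
      Tendsto (fun n => ‖g n - f n‖) atTop (nhds 0) ∧
      Tendsto
        (fun n => sSup {x : ℝ | ∃ τ : A →L[ℂ] ℂ, IsTracialState τ ∧ x = dimFn τ (g n)})
        atTop (nhds 0) := by
  set s : ℕ → ℝ :=
    fun n => sSup {x : ℝ | ∃ τ : A →L[ℂ] ℂ, IsTracialState τ ∧ x = (τ (f n)).re}
  have hle : ∀ n (τ : A →L[ℂ] ℂ), IsTracialState τ → (τ (f n)).re ≤ s n := by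
    intro n τ hτ
    refine le_csSup ⟨1, ?_⟩ ⟨τ, hτ, rfl⟩
    rintro _ ⟨σ, hσ, rfl⟩
    have h1 := hσ.re_mono ((CStarAlgebra.norm_le_one_iff_of_nonneg (f n) (hpos n)).mp (hcontr n))
    simpa [hσ.1] using h1
  have hs0 : ∀ n, 0 ≤ s n := by
    refine fun n => Real.sSup_nonneg ?_
    rintro _ ⟨τ, hτ, rfl⟩
    simpa using hτ.re_mono (hpos n)
  set ε : ℕ → ℝ := fun n => √(s n + 1 / ((n : ℝ) + 1)) with hεdef
  have harg : ∀ n, 0 < s n + 1 / ((n : ℝ) + 1) := fun n =>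
    add_pos_of_nonneg_of_pos (hs0 n) (by positivity)
  have hε : ∀ n, 0 < ε n := fun n => Real.sqrt_pos.mpr (harg n)
  have hεlim : Tendsto ε atTop (nhds 0) := by
    simpa [hεdef] using (h.add tendsto_one_div_add_atTop_nhds_zero_nat).sqrt
  have hsε : ∀ n, s n / ε n ≤ ε n := fun n => by
    rw [div_le_iff₀ (hε n), Real.mul_self_sqrt (harg n).le]
    exact le_add_of_nonneg_right (by positivity)
  refine ⟨fun n => cfc (fun t : ℝ => max (t - ε n) 0) (f n),
    fun n => cfc_nonneg fun t _ => le_max_right _ _,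
    fun n => (norm_cfc_max_sub_le (hpos n) (hε n).le).trans (hcontr n),
    squeeze_zero (fun n => norm_nonneg _)
      (fun n => norm_cfc_max_sub_sub_self_le (hpos n) (hε n).le) hεlim,
    squeeze_zero (fun n => Real.sSup_nonneg ?_) (fun n => Real.sSup_le ?_ (hε n).le) hεlim⟩
  · rintro _ ⟨τ, hτ, rfl⟩
    exact (hτ.dimFn_cfc_max_sub_mem_Icc (hpos n) (hε n)).1
  · rintro _ ⟨τ, hτ, rfl⟩
    refine (hτ.dimFn_cfc_max_sub_mem_Icc (hpos n) (hε n)).2.trans (le_trans ?_ (hsε n))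
    exact div_le_div_of_nonneg_right (hle n τ hτ) (hε n).le
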